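/- arXiv:2202.11815 — 5 statements merged into one kernel-verified Lean document; each statement's English description precedes it below -/
import Mathlib

section
/- For every θ with 0 < θ < 1/2 there exists a constant C = C(θ) > 0 with the following property: for every t ≥ 0 and every nonzero traceless matrix w ∈ Mat_2(ℝ), one has ∫_0^1 ‖(a_t u_r) w (a_t u_r)^{-1}‖^{-(1-θ)} dr ≤ C e^{-θ t} ‖w‖^{-(1-θ)}, where the integral is the Lebesgue integral over r ∈ [0,1]. -/
open MeasureTheory

/-- The matrix `a_t = [[e^{t/2}, 0],[0, e^{-t/2}]]`. -/
noncomputable def aMat (t : ℝ) : Matrix (Fin 2) (Fin 2) ℝ :=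
  !![Real.exp (t/2), 0; 0, Real.exp (-t/2)]

/-- The matrix `u_r = [[1, r],[0, 1]]`. -/
def uMat (r : ℝ) : Matrix (Fin 2) (Fin 2) ℝ :=
  !![1, r; 0, 1]

/-- The maximum norm of a 2×2 real matrix: the maximum of the absolute values of its
entries. -/
noncomputable def mnorm (m : Matrix (Fin 2) (Fin 2) ℝ) : ℝ :=
  max (max |m 0 0| |m 0 1|) (max |m 1 0| |m 1 1|)

/-- Lower bound for a real quadratic on `[0, 1]`, in terms of the size of its coefficients, by the
square of the distance to one of two points. -/
lemma exists_sq_dist_le_abs_quadratic {a b c M : ℝ} (hM : 0 < M)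
    (h : |a| = M ∨ |b| = M ∨ |c| = M) :
    ∃ x y : ℝ, ∀ r ∈ Set.Icc (0:ℝ) 1,
      M / 16 * (r - x) ^ 2 ≤ |b - 2 * a * r - c * r ^ 2| ∨
        M / 16 * (r - y) ^ 2 ≤ |b - 2 * a * r - c * r ^ 2| := by
  by_cases hcM : M / 16 ≤ |c|
  · have hc0 : c ≠ 0 := by
      rintro rfl
      simp at hcM
      linarith
    have hcpos : 0 < |c| := abs_pos.mpr hc0
    rcases le_total (a ^ 2 + b * c) 0 with hD | hD
    · refine ⟨-a / c, 0, fun r _ => Or.inl ?_⟩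
      have h1 : |c| * (|c| * (r - -a / c) ^ 2) ≤ |c| * |b - 2 * a * r - c * r ^ 2| := by
        rw [← abs_mul, ← mul_assoc, abs_mul_abs_self]
        have e : c * c * (r - -a / c) ^ 2 = (a + c * r) ^ 2 := by
          field_simp
          ring
        rw [e]
        refine le_trans ?_ (neg_le_abs _)
        linarith
      exact (mul_le_mul_of_nonneg_right hcM (sq_nonneg _)).trans (le_of_mul_le_mul_left h1 hcpos)
    · set s := Real.sqrt (a ^ 2 + b * c) with hs
      have hss : s ^ 2 = a ^ 2 + b * c := Real.sq_sqrt hD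
      refine ⟨(s - a) / c, (-s - a) / c, fun r _ => ?_⟩
      have e : b - 2 * a * r - c * r ^ 2 = -c * ((r - (s - a) / c) * (r - (-s - a) / c)) := by
        field_simp
        linear_combination -hss
      rw [e, abs_mul, abs_neg, abs_mul]
      rcases le_total |r - (s - a) / c| |r - (-s - a) / c| with hle | hle
      · left
        rw [← sq_abs, sq]
        gcongr
      · right
        rw [← sq_abs, sq]
        gcongr
  · push Not at hcM
    by_cases haM : M / 8 ≤ |a|
    · obtain ⟨x, hx, hmin⟩ := isCompact_Icc.exists_isMinOn (Set.nonempty_Icc.mpr zero_le_one)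
        (f := fun r : ℝ => |b - 2 * a * r - c * r ^ 2|)
        (by fun_prop : ContinuousOn _ (Set.Icc (0:ℝ) 1))
      refine ⟨x, 0, fun r hr => Or.inl ?_⟩
      have h1 : |b - 2 * a * x - c * x ^ 2| ≤ |b - 2 * a * r - c * r ^ 2| := hmin hr
      have h2 : |r - x| * |2 * a + c * (r + x)| ≤
          |b - 2 * a * x - c * x ^ 2| + |b - 2 * a * r - c * r ^ 2| := by
        rw [← abs_mul]
        refine le_trans (le_of_eq ?_) (abs_sub _ _)
        congr 1
        ring
      have h3 : M / 8 ≤ |2 * a + c * (r + x)| := by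
        have h4 : |2 * a| ≤ |2 * a + c * (r + x)| + |c * (r + x)| := by
          simpa using abs_sub (2 * a + c * (r + x)) (c * (r + x))
        have h5 : |c * (r + x)| ≤ M / 16 * 2 := by
          rw [abs_mul]
          gcongr
          rw [abs_le]
          constructor <;> linarith [hr.1, hr.2, hx.1, hx.2]
        rw [abs_mul, abs_two] at h4
        linarith
      have h6 : (r - x) ^ 2 ≤ |r - x| := by
        rw [← sq_abs]
        have : |r - x| ≤ 1 := by
          rw [abs_le]
          constructor <;> linarith [hr.1, hr.2, hx.1, hx.2]
        nlinarith [abs_nonneg (r - x)]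
      nlinarith [abs_nonneg (r - x)]
    · push Not at haM
      have hbM : |b| = M := by
        rcases h with h | h | h
        · linarith
        · exact h
        · linarith
      refine ⟨0, 0, fun r hr => Or.inl ?_⟩
      have hr2 : r ^ 2 ≤ 1 := by nlinarith [hr.1, hr.2]
      have h1 : |2 * a * r| ≤ M / 4 := by
        rw [abs_mul, abs_mul, abs_two, abs_of_nonneg hr.1]
        nlinarith [abs_nonneg a, hr.1, hr.2]
      have h2 : |c * r ^ 2| ≤ M / 16 := by
        rw [abs_mul, abs_of_nonneg (sq_nonneg r)]
        nlinarith [abs_nonneg c]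
      have h3 : |b| ≤ |b - 2 * a * r - c * r ^ 2| + |2 * a * r| + |c * r ^ 2| := by
        have := abs_add_three (b - 2 * a * r - c * r ^ 2) (2 * a * r) (c * r ^ 2)
        rwa [sub_add_eq_add_sub, sub_add_cancel, sub_add_cancel] at this
      rw [sub_zero]
      nlinarith

lemma adjoint_aMat_mul_uMat (t r a b c : ℝ) :
    (aMat t * uMat r) * !![a, b; c, -a] * (aMat t * uMat r)⁻¹ =
      !![a + c * r, Real.exp t * (b - 2 * a * r - c * r ^ 2);
        Real.exp (-t) * c, -(a + c * r)] := by
  have h1 : Real.exp (t / 2) * Real.exp (-t / 2) = 1 := by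
    rw [← Real.exp_add, ← Real.exp_zero]
    ring_nf
  have h2 : Real.exp t = Real.exp (t / 2) ^ 2 := by
    rw [← Real.exp_nat_mul]
    ring_nf
  have h3 : Real.exp (-t) = Real.exp (-t / 2) ^ 2 := by
    rw [← Real.exp_nat_mul]
    ring_nf
  have hinv : (aMat t * uMat r)⁻¹ =
      !![Real.exp (-t / 2), -r * Real.exp (t / 2); 0, Real.exp (t / 2)] := by
    apply Matrix.inv_eq_right_inv
    ext i j
    fin_cases i <;> fin_cases j <;>
      simp [aMat, uMat, Matrix.mul_apply, Fin.sum_univ_two] <;>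
      first | ring1 | linear_combination h1
  rw [hinv, h2, h3]
  ext i j
  fin_cases i <;> fin_cases j <;>
    simp [aMat, uMat, Matrix.mul_apply, Fin.sum_univ_two]
  · linear_combination (a + c * r) * h1
  · ring
  · ring
  · linear_combination (-a - c * r) * h1

/-- Along the expanding horocycle, the norm is bounded below by a rescaled copy of `1 + x ^ 2`
centred at one of two points. -/
lemma exists_le_mnorm_adjoint {t : ℝ} (ht : 0 ≤ t) {w : Matrix (Fin 2) (Fin 2) ℝ} (hw : w ≠ 0)
    (htr : w.trace = 0) :
    0 < mnorm w ∧ ∃ x y : ℝ, ∀ r ∈ Set.Icc (0:ℝ) 1, ∃ z ∈ ({x, y} : Set ℝ),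
      mnorm w / 32 * Real.exp (-t) * (1 + (Real.exp t * (r - z)) ^ 2) ≤
        mnorm ((aMat t * uMat r) * w * (aMat t * uMat r)⁻¹) := by
  obtain ⟨a, b, c, rfl⟩ : ∃ a b c : ℝ, w = !![a, b; c, -a] := by
    refine ⟨w 0 0, w 0 1, w 1 0, ?_⟩
    rw [Matrix.trace_fin_two] at htr
    ext i j
    fin_cases i <;> fin_cases j <;> simp
    linarith
  set M := mnorm !![a, b; c, -a] with hMdef
  have hMeq : M = max (max |a| |b|) (max |c| |a|) := by simp [hMdef, mnorm]
  have ha : |a| ≤ M := by simp [hMeq]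
  have hb : |b| ≤ M := by simp [hMeq]
  have hc : |c| ≤ M := by simp [hMeq]
  have hM : |a| = M ∨ |b| = M ∨ |c| = M := by
    rw [hMeq]
    rcases max_choice (max |a| |b|) (max |c| |a|) with h | h <;> rw [h]
    · rcases max_choice |a| |b| with h | h <;> simp only [h, true_or, or_true]
    · rcases max_choice |c| |a| with h | h <;> simp only [h, true_or, or_true]
  have hMpos : 0 < M := by
    by_contra hneg
    push Not at hneg
    have ha0 : a = 0 := abs_nonpos_iff.mp (ha.trans hneg)
    have hb0 : b = 0 := abs_nonpos_iff.mp (hb.trans hneg)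
    have hc0 : c = 0 := abs_nonpos_iff.mp (hc.trans hneg)
    apply hw
    ext i j
    fin_cases i <;> fin_cases j <;> simp [ha0, hb0, hc0]
  refine ⟨hMpos, ?_⟩
  obtain ⟨x, y, hxy⟩ := exists_sq_dist_le_abs_quadratic hMpos hM
  refine ⟨x, y, fun r hr => ?_⟩
  rw [adjoint_aMat_mul_uMat]
  set p := b - 2 * a * r - c * r ^ 2 with hp
  set N := mnorm !![a + c * r, Real.exp t * p; Real.exp (-t) * c, -(a + c * r)] with hN
  have hE : 1 ≤ Real.exp t := Real.one_le_exp ht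
  have hEE : Real.exp (-t) * Real.exp t = 1 := by rw [← Real.exp_add]; simp
  have hE0 : 0 < Real.exp (-t) := Real.exp_pos _
  have hN1 : |a + c * r| ≤ N := by simp [hN, mnorm]
  have hN2 : Real.exp t * |p| ≤ N := by simp [hN, mnorm, abs_mul]
  have hN3 : Real.exp (-t) * |c| ≤ N := by simp [hN, mnorm, abs_mul]
  have hN0 : 0 ≤ N := (abs_nonneg _).trans hN1
  have hNE : N ≤ Real.exp t * N := by nlinarith
  have hlow : M / 16 * Real.exp (-t) ≤ N := by
    have k1 : |c| ≤ Real.exp t * N := by nlinarith [Real.exp_pos t]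
    have k2 : |a + c * r| ≤ Real.exp t * N := by linarith
    have k3 : |p| ≤ Real.exp t * N := by nlinarith [abs_nonneg p]
    have k4 : |c * r| ≤ |c| := by
      rw [abs_mul, abs_of_nonneg hr.1]
      exact mul_le_of_le_one_right (abs_nonneg _) hr.2
    have k5 : |a| ≤ 2 * (Real.exp t * N) := by
      have := abs_sub (a + c * r) (c * r)
      rw [add_sub_cancel_right] at this
      linarith
    have k6 : |2 * a * r| ≤ 2 * |a| := by
      rw [abs_mul, abs_mul, abs_two, abs_of_nonneg hr.1]
      exact mul_le_of_le_one_right (by positivity) hr.2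
    have k7 : |c * r ^ 2| ≤ |c| := by
      rw [abs_mul, abs_of_nonneg (sq_nonneg r)]
      exact mul_le_of_le_one_right (abs_nonneg _) (by nlinarith [hr.1, hr.2])
    have k8 : |b| ≤ |p| + |2 * a * r| + |c * r ^ 2| := by
      have := abs_add_three p (2 * a * r) (c * r ^ 2)
      rwa [hp, sub_add_eq_add_sub, sub_add_cancel, sub_add_cancel] at this
    have k9 : M / 16 ≤ Real.exp t * N := by
      rcases hM with h | h | h <;> rw [← h] <;> nlinarith
    calc M / 16 * Real.exp (-t) ≤ Real.exp t * N * Real.exp (-t) := by gcongr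
      _ = N := by linear_combination N * hEE
  have key : ∀ z, M / 16 * (r - z) ^ 2 ≤ |p| →
      M / 32 * Real.exp (-t) * (1 + (Real.exp t * (r - z)) ^ 2) ≤ N := by
    intro z hz
    have h1 : Real.exp t * (M / 16 * (r - z) ^ 2) ≤ N :=
      (mul_le_mul_of_nonneg_left hz (Real.exp_pos t).le).trans hN2
    have e : M / 32 * Real.exp (-t) * (1 + (Real.exp t * (r - z)) ^ 2) =
        (M / 16 * Real.exp (-t) + Real.exp t * (M / 16 * (r - z) ^ 2)) / 2 := by
      linear_combination (M / 32 * Real.exp t * (r - z) ^ 2) * hEE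
    rw [e]
    linarith
  rcases hxy r hr with h | h
  · exact ⟨x, by simp, key x h⟩
  · exact ⟨y, by simp, key y h⟩

/-- For every `0 < θ < 1/2` there is `C = C(θ) > 0` such that for every `t ≥ 0` and every
nonzero traceless `w ∈ Mat₂(ℝ)`,
`∫_0^1 ‖(a_t u_r) w (a_t u_r)⁻¹‖^{-(1-θ)} dr ≤ C e^{-θt} ‖w‖^{-(1-θ)}`. -/
theorem integral_rpow_adjoint_decay :
    ∀ θ : ℝ, 0 < θ → θ < 1/2 →
      ∃ C : ℝ, 0 < C ∧
        ∀ t : ℝ, 0 ≤ t → ∀ w : Matrix (Fin 2) (Fin 2) ℝ, w ≠ 0 → w.trace = 0 →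
          (∫ r in Set.Icc (0:ℝ) 1,
              mnorm ((aMat t * uMat r) * w * (aMat t * uMat r)⁻¹) ^ (-(1-θ)))
            ≤ C * Real.exp (-θ * t) * mnorm w ^ (-(1-θ)) := by
  intro θ hθ0 hθ
  let g : ℝ → ℝ := fun x => (1 + x ^ 2) ^ (-(1 - θ))
  have hg0 : ∀ x, 0 ≤ g x := fun x => by positivity
  have hg : Integrable g := by
    have h := integrable_rpow_neg_one_add_norm_sq (E := ℝ) (μ := volume) (r := 2 * (1 - θ))
      (by simp; linarith)
    convert h using 2 with x
    simp only [g, Real.norm_eq_abs, sq_abs]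
    congr 1
    ring
  have hK : 0 ≤ ∫ x, g x := integral_nonneg hg0
  refine ⟨(32:ℝ) ^ (1 - θ) * (2 * (∫ x, g x) + 1), by positivity, fun t ht w hw htr => ?_⟩
  obtain ⟨hMpos, x, y, hxy⟩ := exists_le_mnorm_adjoint ht hw htr
  set M := mnorm w
  let A : ℝ := (M / 32 * Real.exp (-t)) ^ (-(1 - θ))
  have hA0 : 0 ≤ A := by positivity
  have hscaled (z : ℝ) : Integrable (fun r => g (Real.exp t * (r - z))) :=
    (hg.comp_mul_left' (Real.exp_ne_zero t)).comp_sub_right z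
  have hint (z : ℝ) : ∫ r, g (Real.exp t * (r - z)) = Real.exp (-t) * ∫ x, g x := by
    rw [integral_sub_right_eq_self (fun r => g (Real.exp t * r)) z,
      Measure.integral_comp_mul_left, abs_of_pos (by positivity), ← Real.exp_neg, smul_eq_mul]
  let G : ℝ → ℝ := fun r => A * (g (Real.exp t * (r - x)) + g (Real.exp t * (r - y)))
  have hG : Integrable G := ((hscaled x).add (hscaled y)).const_mul A
  have hAeq : A * Real.exp (-t) = (32:ℝ) ^ (1 - θ) * Real.exp (-θ * t) * M ^ (-(1 - θ)) := by
    have e1 : A = M ^ (-(1 - θ)) * (32:ℝ) ^ (1 - θ) * Real.exp (t * (1 - θ)) := by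
      simp only [A]
      rw [Real.mul_rpow (by positivity) (by positivity), Real.div_rpow hMpos.le (by norm_num),
        ← Real.exp_mul, Real.rpow_neg (by norm_num : (0:ℝ) ≤ 32), div_inv_eq_mul]
      congr 2
      ring
    have e2 : Real.exp (t * (1 - θ)) * Real.exp (-t) = Real.exp (-θ * t) := by
      rw [← Real.exp_add]
      congr 1
      ring
    rw [e1, ← e2]
    ring
  calc (∫ r in Set.Icc (0:ℝ) 1,
          mnorm ((aMat t * uMat r) * w * (aMat t * uMat r)⁻¹) ^ (-(1-θ)))
      ≤ ∫ r in Set.Icc (0:ℝ) 1, G r := by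
        refine integral_mono_of_nonneg (Filter.Eventually.of_forall fun r => ?_)
          hG.integrableOn ?_
        · exact Real.rpow_nonneg (by simp [mnorm]) _
        · filter_upwards [ae_restrict_mem measurableSet_Icc] with r hr
          obtain ⟨z, hz, hle⟩ := hxy r hr
          have h1 := Real.rpow_le_rpow_of_nonpos (by positivity) hle
            (by linarith : -(1 - θ) ≤ 0)
          rw [Real.mul_rpow (by positivity) (by positivity)] at h1
          refine h1.trans (mul_le_mul_of_nonneg_left ?_ hA0)
          rcases hz with rfl | rfl
          · exact le_add_of_nonneg_right (hg0 _)
          · exact le_add_of_nonneg_left (hg0 _)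
    _ ≤ ∫ r, G r := setIntegral_le_integral hG
        (Filter.Eventually.of_forall fun r => mul_nonneg hA0 (add_nonneg (hg0 _) (hg0 _)))
    _ = A * Real.exp (-t) * (2 * ∫ x, g x) := by
        rw [integral_const_mul, integral_add (hscaled x) (hscaled y), hint, hint]
        ring
    _ ≤ A * Real.exp (-t) * (2 * (∫ x, g x) + 1) := by
        gcongr
        linarith
    _ = _ := by
        rw [hAeq]
        ring
end

section
/- There exists an absolute constant C > 0 with the following property: for every nonzero traceless matrix w ∈ Mat_2(ℝ), every t ≥ 0 and every λ > 0, the Lebesgue measure of the set {r ∈ [0,1] : ‖(a_t u_r) w (a_t u_r)^{-1}‖ ≤ λ ‖w‖} is at most C λ. -/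
open MeasureTheory

lemma adjoint_apply_zero_zero (t r a b c : ℝ) :
    ((aMat t * uMat r) * !![a, b; c, -a] * (aMat t * uMat r)⁻¹) 0 0 = a + c * r := by
  have h : Real.exp (t / 2) * Real.exp (-t / 2) = 1 := by
    rw [← Real.exp_add]; simp [neg_div]
  simp [aMat, uMat, Matrix.inv_def, Matrix.det_fin_two, Matrix.adjugate_fin_two, h]
  linear_combination (a + c * r) * h

lemma adjoint_apply_zero_one (t r a b c : ℝ) :
    ((aMat t * uMat r) * !![a, b; c, -a] * (aMat t * uMat r)⁻¹) 0 1 =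
      Real.exp t * (b - 2 * a * r - c * r ^ 2) := by
  have h : Real.exp (t / 2) * Real.exp (-t / 2) = 1 := by
    rw [← Real.exp_add]; simp [neg_div]
  have h' : Real.exp t = Real.exp (t / 2) * Real.exp (t / 2) := by
    rw [← Real.exp_add]; simp
  simp [aMat, uMat, Matrix.inv_def, Matrix.det_fin_two, Matrix.adjugate_fin_two, h, h']
  ring

/-- If the conjugate of a matrix by `a_t u_r` is much smaller than the matrix, then its
lower left entry is comparable to its norm. -/
lemma le_abs_of_adjoint_small {a b c r M lam : ℝ} (hM : 0 < M) (hr : r ∈ Set.Icc (0 : ℝ) 1)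
    (hlam : lam < 1 / 20) (hmax : |a| = M ∨ |b| = M ∨ |c| = M)
    (hlin : |a + c * r| ≤ lam * M) (hquad : |b - 2 * a * r - c * r ^ 2| ≤ lam * M) :
    M / 10 ≤ |c| := by
  obtain ⟨h0, h1⟩ := hr
  by_contra! hc
  have hl : lam * M < M / 20 := by nlinarith
  have hcr : |c * r| ≤ |c| := by
    rw [abs_mul, abs_of_nonneg h0]; nlinarith [abs_nonneg c]
  have hcr2 : |c * r ^ 2| ≤ |c| := by
    rw [abs_mul, abs_of_nonneg (sq_nonneg r)]
    exact mul_le_of_le_one_right (abs_nonneg c) (pow_le_one₀ h0 h1)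
  have har : |2 * a * r| ≤ 2 * |a| := by
    rw [abs_mul, abs_mul, abs_of_nonneg h0, abs_two]; nlinarith [abs_nonneg a]
  have ha : |a| ≤ |a + c * r| + |c * r| := by
    simpa using abs_sub (a + c * r) (c * r)
  have hb : |b| ≤ |b - 2 * a * r - c * r ^ 2| + |2 * a * r| + |c * r ^ 2| := by
    have := abs_add_three (b - 2 * a * r - c * r ^ 2) (2 * a * r) (c * r ^ 2)
    rwa [show b - 2 * a * r - c * r ^ 2 + 2 * a * r + c * r ^ 2 = b by ring] at this
  rcases hmax with h | h | h <;> linarith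

/-- There is an absolute constant `C > 0` such that for every nonzero traceless
`w ∈ Mat₂(ℝ)`, every `t ≥ 0` and every `λ > 0`, the Lebesgue measure of
`{r ∈ [0,1] : ‖(a_t u_r) w (a_t u_r)⁻¹‖ ≤ λ ‖w‖}` is at most `C λ`. -/
theorem measure_small_adjoint_le :
    ∃ C : ℝ, 0 < C ∧
      ∀ w : Matrix (Fin 2) (Fin 2) ℝ, w ≠ 0 → w.trace = 0 →
        ∀ t : ℝ, 0 ≤ t → ∀ lam : ℝ, 0 < lam →
          volume {r ∈ Set.Icc (0:ℝ) 1 |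
              mnorm ((aMat t * uMat r) * w * (aMat t * uMat r)⁻¹) ≤ lam * mnorm w}
            ≤ ENNReal.ofReal (C * lam) := by
  refine ⟨20, by norm_num, fun w hw htr t ht lam hlam => ?_⟩
  obtain ⟨a, b, c, rfl⟩ : ∃ a b c : ℝ, w = !![a, b; c, -a] := by
    refine ⟨w 0 0, w 0 1, w 1 0, ?_⟩
    rw [Matrix.trace_fin_two] at htr
    ext i j
    fin_cases i <;> fin_cases j <;> simp
    linarith
  set M := mnorm !![a, b; c, -a] with hMdef
  have hMeq : M = max (max |a| |b|) (max |c| |a|) := by simp [hMdef, mnorm]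
  have hmax : |a| = M ∨ |b| = M ∨ |c| = M := by grind
  have hM : 0 < M := by
    by_contra! hM
    have ha : |a| ≤ 0 := by grind
    have hb : |b| ≤ 0 := by grind
    have hc : |c| ≤ 0 := by grind
    rw [abs_nonpos_iff] at ha hb hc
    subst ha hb hc
    exact hw (by ext i j; fin_cases i <;> fin_cases j <;> simp)
  have key : ∀ r, mnorm ((aMat t * uMat r) * !![a, b; c, -a] * (aMat t * uMat r)⁻¹) ≤ lam * M →
      |a + c * r| ≤ lam * M ∧ |b - 2 * a * r - c * r ^ 2| ≤ lam * M := by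
    intro r h
    rw [mnorm, max_le_iff, max_le_iff, adjoint_apply_zero_zero, adjoint_apply_zero_one,
      abs_mul, Real.abs_exp] at h
    exact ⟨h.1.1, (le_mul_of_one_le_left (abs_nonneg _) (Real.one_le_exp ht)).trans h.1.2⟩
  refine (Real.volume_le_diam _).trans (Metric.ediam_le fun r hr s hs => ?_)
  rw [edist_dist]
  apply ENNReal.ofReal_le_ofReal
  obtain ⟨hr, hr'⟩ := hr
  obtain ⟨hs, hs'⟩ := hs
  rw [Real.dist_eq]
  by_cases hl : lam < 1 / 20
  · obtain ⟨hr1, hr2⟩ := key r hr'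
    have hc := le_abs_of_adjoint_small hM hr hl hmax hr1 hr2
    have hsub : |c| * |r - s| ≤ 2 * (lam * M) := by
      rw [← abs_mul, show c * (r - s) = (a + c * r) - (a + c * s) by ring]
      linarith [abs_sub (a + c * r) (a + c * s), (key s hs').1]
    have := mul_le_mul_of_nonneg_right hc (abs_nonneg (r - s))
    nlinarith
  · have : |r - s| ≤ 1 := abs_le.2 ⟨by linarith [hr.1, hs.2], by linarith [hr.2, hs.1]⟩
    linarith
end

section
/- For every α with 0 < α < 1/2 there exists a constant C = C(α) > 0 such that for every real polynomial q of degree at most 2 that is not identically zero, the Lebesgue integral ∫_0^1 |q(r)|^{-α} dr is finite and satisfies ∫_0^1 |q(r)|^{-α} dr ≤ C (sup_{r ∈ [0,1]} |q(r)|)^{-α}. -/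
open MeasureTheory

/-- Each complex linear factor on `[0,1]` is controlled from below by a real linear factor with
root in `[0,1]`, uniformly in the value of the factor at any other point. -/
lemma exists_norm_sub_mul_abs_sub_le (z : ℂ) :
    ∃ a ∈ Set.Icc (0:ℝ) 1, ∀ r ∈ Set.Icc (0:ℝ) 1, ∀ s ∈ Set.Icc (0:ℝ) 1,
      ‖(s:ℂ) - z‖ * |r - a| ≤ 2 * ‖(r:ℂ) - z‖ := by
  refine ⟨max 0 (min 1 z.re), ⟨le_max_left _ _, by simp⟩, fun r hr s hs => ?_⟩
  have hre : |r - z.re| ≤ ‖(r:ℂ) - z‖ := by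
    simpa using Complex.abs_re_le_norm ((r:ℂ) - z)
  have hclamp : |r - max 0 (min 1 z.re)| ≤ |r - z.re| := by
    obtain ⟨h0, h1⟩ := hr
    grind
  have hone : |r - max 0 (min 1 z.re)| ≤ 1 := by
    obtain ⟨h0, h1⟩ := hr
    grind
  have htri : ‖(s:ℂ) - z‖ ≤ 1 + ‖(r:ℂ) - z‖ := by
    have hsr : ‖(s:ℂ) - r‖ ≤ 1 := by
      rw [← Complex.ofReal_sub, Complex.norm_real, Real.norm_eq_abs, abs_le]
      constructor <;> linarith [hr.1, hr.2, hs.1, hs.2]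
    calc ‖(s:ℂ) - z‖ = ‖((s:ℂ) - r) + (r - z)‖ := by ring_nf
      _ ≤ ‖(s:ℂ) - r‖ + ‖(r:ℂ) - z‖ := norm_add_le _ _
      _ ≤ _ := by linarith
  nlinarith [abs_nonneg (r - max 0 (min 1 z.re)), norm_nonneg ((r:ℂ) - z)]

/-- A real polynomial of degree at most 2 is bounded below on `[0,1]` by its sup norm times a
product of two real linear factors. -/
lemma exists_abs_quadratic_mul_le (c₀ c₁ c₂ : ℝ) :
    ∃ a b : ℝ, a ∈ Set.Icc (0:ℝ) 1 ∧ b ∈ Set.Icc (0:ℝ) 1 ∧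
      ∀ r ∈ Set.Icc (0:ℝ) 1, ∀ s ∈ Set.Icc (0:ℝ) 1,
        |c₀ + c₁ * s + c₂ * s ^ 2| * (|r - a| * |r - b|) ≤
          4 * |c₀ + c₁ * r + c₂ * r ^ 2| := by
  have habs : ∀ x : ℝ, |c₀ + c₁ * x + c₂ * x ^ 2| =
      ‖(c₀:ℂ) + c₁ * x + c₂ * x ^ 2‖ := fun x => by
    rw [← Real.norm_eq_abs, ← Complex.norm_real]; push_cast; rfl
  by_cases h₂ : c₂ = 0
  · by_cases h₁ : c₁ = 0
    · refine ⟨0, 0, by simp, by simp, fun r hr s _ => ?_⟩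
      simp only [h₁, h₂, zero_mul, add_zero, sub_zero, abs_of_nonneg hr.1]
      nlinarith [abs_nonneg c₀, mul_le_one₀ hr.2 hr.1 hr.2]
    · obtain ⟨a, ha, h⟩ := exists_norm_sub_mul_abs_sub_le (-c₀ / c₁)
      refine ⟨a, 0, ha, by simp, fun r hr s hs => ?_⟩
      have hfac : ∀ x : ℝ, |c₀ + c₁ * x + c₂ * x ^ 2| =
          ‖(c₁:ℂ)‖ * ‖(x:ℂ) - -c₀ / c₁‖ := fun x => by
        have : (c₁:ℂ) ≠ 0 := by exact_mod_cast h₁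
        rw [habs, ← norm_mul]
        congr 1
        rw [h₂]
        push_cast
        field_simp
        ring
      rw [hfac, hfac, sub_zero, abs_of_nonneg hr.1]
      calc _ = ‖(c₁:ℂ)‖ * (‖(s:ℂ) - -c₀ / c₁‖ * |r - a|) * r := by ring
        _ ≤ ‖(c₁:ℂ)‖ * (2 * ‖(r:ℂ) - -c₀ / c₁‖) * 1 :=
          mul_le_mul (mul_le_mul_of_nonneg_left (h r hr s hs) (norm_nonneg _)) hr.2 hr.1
            (by positivity)
        _ ≤ _ := by nlinarith [mul_nonneg (norm_nonneg (c₁:ℂ)) (norm_nonneg ((r:ℂ) - -c₀ / c₁))]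
  · obtain ⟨d, hd⟩ := IsAlgClosed.exists_pow_nat_eq ((c₁:ℂ) ^ 2 - 4 * c₀ * c₂) two_pos
    obtain ⟨z, hz⟩ : ∃ z : ℂ, z = (-c₁ + d) / (2 * c₂) := ⟨_, rfl⟩
    obtain ⟨w, hw⟩ : ∃ w : ℂ, w = (-c₁ - d) / (2 * c₂) := ⟨_, rfl⟩
    obtain ⟨a, ha, hza⟩ := exists_norm_sub_mul_abs_sub_le z
    obtain ⟨b, hb, hwb⟩ := exists_norm_sub_mul_abs_sub_le w
    refine ⟨a, b, ha, hb, fun r hr s hs => ?_⟩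
    have hfac : ∀ x : ℝ, |c₀ + c₁ * x + c₂ * x ^ 2| =
        ‖(c₂:ℂ)‖ * (‖(x:ℂ) - z‖ * ‖(x:ℂ) - w‖) := fun x => by
      have : (c₂:ℂ) ≠ 0 := by exact_mod_cast h₂
      rw [habs, ← norm_mul, ← norm_mul]
      congr 1
      rw [hz, hw]
      field_simp
      linear_combination hd
    rw [hfac, hfac]
    calc _ = ‖(c₂:ℂ)‖ * ((‖(s:ℂ) - z‖ * |r - a|) * (‖(s:ℂ) - w‖ * |r - b|)) := by ring
      _ ≤ ‖(c₂:ℂ)‖ * ((2 * ‖(r:ℂ) - z‖) * (2 * ‖(r:ℂ) - w‖)) :=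
        mul_le_mul_of_nonneg_left
          (mul_le_mul (hza r hr s hs) (hwb r hr s hs) (by positivity) (by positivity))
          (norm_nonneg _)
      _ = _ := by ring

lemma lintegral_abs_rpow_ne_top {p : ℝ} (hp : -1 < p) :
    ∫⁻ u in Set.Icc (-1:ℝ) 1, ENNReal.ofReal (|u| ^ p) ≠ ⊤ := by
  have hpos : IntervalIntegrable (fun x : ℝ => |x| ^ p) volume 0 1 :=
    (intervalIntegral.intervalIntegrable_rpow' hp).congr fun x hx => by
      rw [Set.uIoc_of_le zero_le_one] at hx
      simp only [abs_of_pos hx.1]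
  have hneg : IntervalIntegrable (fun x : ℝ => |x| ^ p) volume (-1) 0 := by
    simpa using ((IntervalIntegrable.iff_comp_neg).1 hpos).symm
  have hint : IntegrableOn (fun x : ℝ => |x| ^ p) (Set.Icc (-1:ℝ) 1) :=
    (intervalIntegrable_iff_integrableOn_Icc_of_le (by norm_num)).1 (hneg.trans hpos)
  exact hint.lintegral_lt_top.ne

lemma lintegral_abs_sub_rpow_le (p : ℝ) {a : ℝ} (ha : a ∈ Set.Icc (0:ℝ) 1) :
    ∫⁻ r in Set.Icc (0:ℝ) 1, ENNReal.ofReal (|r - a| ^ p) ≤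
      ∫⁻ u in Set.Icc (-1:ℝ) 1, ENNReal.ofReal (|u| ^ p) := by
  rw [← lintegral_indicator measurableSet_Icc, ← lintegral_indicator measurableSet_Icc,
    ← lintegral_sub_right_eq_self ((Set.Icc (-1:ℝ) 1).indicator _) a]
  refine lintegral_mono fun r => ?_
  by_cases hr : r ∈ Set.Icc (0:ℝ) 1
  · have : r - a ∈ Set.Icc (-1:ℝ) 1 :=
      ⟨by linarith [hr.1, ha.2], by linarith [hr.2, ha.1]⟩
    simp only [Set.indicator_of_mem hr, Set.indicator_of_mem this, le_refl]
  · simp only [Set.indicator_of_notMem hr, zero_le]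

lemma rpow_neg_le_of_mul_le {α M t x y : ℝ} (hα : 0 < α) (hM : 0 < M) (hx : 0 < x) (hy : 0 < y)
    (h : M * (x * y) ≤ 4 * t) :
    t ^ (-α) ≤ 4 ^ α * M ^ (-α) * (x ^ (-(2 * α)) + y ^ (-(2 * α))) := by
  have hsq : ∀ u : ℝ, 0 < u → u ^ (-(2 * α)) = (u ^ (-α)) ^ 2 := fun u hu => by
    rw [← Real.rpow_natCast, ← Real.rpow_mul hu.le]
    congr 1
    push_cast
    ring
  have hbound : t ^ (-α) ≤ (4⁻¹ * (M * (x * y))) ^ (-α) :=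
    Real.rpow_le_rpow_of_nonpos (by positivity) (by linarith) (by linarith)
  have hfour : (4⁻¹ : ℝ) ^ (-α) = 4 ^ α := by
    rw [Real.inv_rpow (by norm_num), Real.rpow_neg (by norm_num), inv_inv]
  rw [Real.mul_rpow (by norm_num) (by positivity), Real.mul_rpow hM.le (by positivity),
    Real.mul_rpow hx.le hy.le, hfour, ← mul_assoc] at hbound
  refine hbound.trans (mul_le_mul_of_nonneg_left ?_ (by positivity))
  rw [hsq x hx, hsq y hy]
  nlinarith [sq_nonneg (x ^ (-α) - y ^ (-α)), sq_nonneg (x ^ (-α)), sq_nonneg (y ^ (-α))]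

/-- The supremum of a nonzero quadratic over `[0,1]` is positive and attained. -/
lemma exists_iSup_abs_quadratic_eq {c₀ c₁ c₂ : ℝ} (hc : ¬(c₀ = 0 ∧ c₁ = 0 ∧ c₂ = 0)) :
    ∃ s ∈ Set.Icc (0:ℝ) 1,
      (⨆ r : Set.Icc (0:ℝ) 1, |c₀ + c₁ * (r : ℝ) + c₂ * (r : ℝ) ^ 2|) =
        |c₀ + c₁ * s + c₂ * s ^ 2| ∧ 0 < |c₀ + c₁ * s + c₂ * s ^ 2| := by
  obtain ⟨s, hs, hmax⟩ := (isCompact_Icc (a := (0:ℝ)) (b := 1)).exists_isMaxOn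
    (by simp) (f := fun r => |c₀ + c₁ * r + c₂ * r ^ 2|) (by fun_prop)
  have hle : ∀ r ∈ Set.Icc (0:ℝ) 1,
      |c₀ + c₁ * r + c₂ * r ^ 2| ≤ |c₀ + c₁ * s + c₂ * s ^ 2| := fun r hr => hmax hr
  refine ⟨s, hs, le_antisymm (ciSup_le fun r => hle r r.2) ?_, ?_⟩
  · exact le_ciSup (f := fun r : Set.Icc (0:ℝ) 1 => |c₀ + c₁ * (r : ℝ) + c₂ * (r : ℝ) ^ 2|)
      ⟨_, by rintro _ ⟨r, rfl⟩; exact hle r r.2⟩ ⟨s, hs⟩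
  · by_contra hzero
    have hvanish : ∀ r ∈ Set.Icc (0:ℝ) 1, c₀ + c₁ * r + c₂ * r ^ 2 = 0 := fun r hr =>
      abs_nonpos_iff.1 ((hle r hr).trans (not_lt.1 hzero))
    have h0 := hvanish 0 (by norm_num)
    have h1 := hvanish 1 (by norm_num)
    have h2 := hvanish (1/2) (by norm_num)
    exact hc ⟨by linarith, by linarith, by linarith⟩

/-- For every `0 < α < 1/2` there is `C = C(α) > 0` such that for every real polynomial
`q(r) = c₀ + c₁ r + c₂ r²` of degree at most 2 which is not identically zero, the
Lebesgue integral `∫_0^1 |q(r)|^{-α} dr` is finite and satisfies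
`∫_0^1 |q(r)|^{-α} dr ≤ C (sup_{[0,1]} |q|)^{-α}`. -/
theorem integral_rpow_quadratic_good :
    ∀ α : ℝ, 0 < α → α < 1/2 →
      ∃ C : ℝ, 0 < C ∧
        ∀ c₀ c₁ c₂ : ℝ, ¬(c₀ = 0 ∧ c₁ = 0 ∧ c₂ = 0) →
          (∫⁻ r in Set.Icc (0:ℝ) 1,
              ENNReal.ofReal (|c₀ + c₁ * r + c₂ * r ^ 2| ^ (-α))) ≠ ⊤ ∧
          (∫⁻ r in Set.Icc (0:ℝ) 1,
              ENNReal.ofReal (|c₀ + c₁ * r + c₂ * r ^ 2| ^ (-α)))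
            ≤ ENNReal.ofReal
                (C * (⨆ r : Set.Icc (0:ℝ) 1,
                    |c₀ + c₁ * (r : ℝ) + c₂ * (r : ℝ) ^ 2|) ^ (-α)) := by
  intro α hα hα2
  set K := ∫⁻ u in Set.Icc (-1:ℝ) 1, ENNReal.ofReal (|u| ^ (-(2 * α)))
  have hKtop : K ≠ ⊤ := lintegral_abs_rpow_ne_top (by linarith)
  refine ⟨4 ^ α * (2 * K.toReal + 1), by positivity, fun c₀ c₁ c₂ hc => ?_⟩
  obtain ⟨s, hs, hsup, hpos⟩ := exists_iSup_abs_quadratic_eq hc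
  obtain ⟨a, b, ha, hb, hab⟩ := exists_abs_quadratic_mul_le c₀ c₁ c₂
  rw [hsup]
  set M := |c₀ + c₁ * s + c₂ * s ^ 2|
  refine (fun h => ⟨ne_top_of_le_ne_top ENNReal.ofReal_ne_top h, h⟩) ?_
  have hae : ∀ᵐ r ∂(volume.restrict (Set.Icc (0:ℝ) 1)),
      ENNReal.ofReal (|c₀ + c₁ * r + c₂ * r ^ 2| ^ (-α)) ≤
        ENNReal.ofReal (4 ^ α * M ^ (-α)) *
          (ENNReal.ofReal (|r - a| ^ (-(2 * α))) + ENNReal.ofReal (|r - b| ^ (-(2 * α)))) := by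
    filter_upwards [ae_restrict_mem measurableSet_Icc, Measure.ae_ne _ a, Measure.ae_ne _ b]
      with r hr hra hrb
    rw [← ENNReal.ofReal_add (by positivity) (by positivity),
      ← ENNReal.ofReal_mul (by positivity)]
    exact ENNReal.ofReal_le_ofReal (rpow_neg_le_of_mul_le hα hpos
      (abs_pos.2 (sub_ne_zero.2 hra)) (abs_pos.2 (sub_ne_zero.2 hrb)) (hab r hr s hs))
  calc _ ≤ _ := lintegral_mono_ae hae
    _ = ENNReal.ofReal (4 ^ α * M ^ (-α)) *
          ((∫⁻ r in Set.Icc (0:ℝ) 1, ENNReal.ofReal (|r - a| ^ (-(2 * α)))) +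
            ∫⁻ r in Set.Icc (0:ℝ) 1, ENNReal.ofReal (|r - b| ^ (-(2 * α)))) := by
      rw [lintegral_const_mul _ (by fun_prop), lintegral_add_left (by fun_prop)]
    _ ≤ ENNReal.ofReal (4 ^ α * M ^ (-α)) * (K + K) := by
      gcongr
      · exact lintegral_abs_sub_rpow_le _ ha
      · exact lintegral_abs_sub_rpow_le _ hb
    _ = ENNReal.ofReal (4 ^ α * M ^ (-α) * (K.toReal + K.toReal)) := by
      rw [ENNReal.ofReal_mul (p := 4 ^ α * M ^ (-α)) (by positivity),
        ENNReal.ofReal_add ENNReal.toReal_nonneg ENNReal.toReal_nonneg,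
        ENNReal.ofReal_toReal hKtop]
    _ ≤ _ := by
      refine ENNReal.ofReal_le_ofReal ?_
      have : 0 < (4:ℝ) ^ α * M ^ (-α) := by positivity
      linarith
end

section
/- There exists an absolute constant c > 0 such that for every traceless matrix w ∈ Mat_2(ℝ), sup_{r ∈ [0,1]} |q_w(r)| ≥ c ‖w‖, where q_w(r) = w_{12} + r (w_{22} - w_{11}) - r^2 w_{21} is the (1,2)-entry of u_r w u_{-r}. -/
/-- The coefficients of a real quadratic polynomial are bounded by eight times any bound on its
absolute value at `0`, `1/2` and `1`. -/
lemma abs_coeff_le_of_abs_quadratic_le {a b d S : ℝ} (h₀ : |a| ≤ S)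
    (h₁ : |a + b / 2 + d / 4| ≤ S) (h₂ : |a + b + d| ≤ S) :
    |b| ≤ 8 * S ∧ |d| ≤ 8 * S := by
  rw [abs_le] at h₀ h₁ h₂
  constructor <;> rw [abs_le] <;> constructor <;> linarith

/-- There is an absolute constant `c > 0` such that for every traceless `w ∈ Mat₂(ℝ)`,
`sup_{r ∈ [0,1]} |q_w(r)| ≥ c ‖w‖`, where
`q_w(r) = w₁₂ + r (w₂₂ - w₁₁) - r² w₂₁` is the `(1,2)`-entry of `u_r w u_{-r}`. -/
theorem sup_quadratic_ge_norm :
    ∃ c : ℝ, 0 < c ∧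
      ∀ w : Matrix (Fin 2) (Fin 2) ℝ, w.trace = 0 →
        c * mnorm w ≤
          ⨆ r : Set.Icc (0:ℝ) 1,
            |w 0 1 + (r : ℝ) * (w 1 1 - w 0 0) - (r : ℝ) ^ 2 * w 1 0| := by
  refine ⟨1 / 8, by norm_num, fun w hw => ?_⟩
  rw [Matrix.trace_fin_two] at hw
  set f : Set.Icc (0:ℝ) 1 → ℝ := fun r =>
    |w 0 1 + (r : ℝ) * (w 1 1 - w 0 0) - (r : ℝ) ^ 2 * w 1 0| with hf
  have hbdd : BddAbove (Set.range f) :=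
    (isCompact_range (by fun_prop)).bddAbove
  have h₀ : |w 0 1| ≤ ⨆ r, f r := by
    simpa [hf] using le_ciSup hbdd ⟨0, by norm_num, by norm_num⟩
  have h₁ : |w 0 1 + (w 1 1 - w 0 0) / 2 + -w 1 0 / 4| ≤ ⨆ r, f r := by
    refine le_trans (le_of_eq ?_) (le_ciSup hbdd ⟨1 / 2, by norm_num, by norm_num⟩)
    simp only [hf]
    ring_nf
  have h₂ : |w 0 1 + (w 1 1 - w 0 0) + -w 1 0| ≤ ⨆ r, f r := by
    refine le_trans (le_of_eq ?_) (le_ciSup hbdd ⟨1, by norm_num, by norm_num⟩)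
    simp only [hf]
    ring_nf
  obtain ⟨hb, hd⟩ := abs_coeff_le_of_abs_quadratic_le h₀ h₁ h₂
  have hS := (abs_nonneg _).trans h₀
  rw [abs_neg] at hd
  rw [abs_le] at hb
  suffices mnorm w ≤ 8 * ⨆ r, f r by linarith
  refine max_le (max_le ?_ (by linarith)) (max_le hd ?_) <;>
    rw [abs_le] <;> constructor <;> linarith
end

section
/- Let w ∈ Mat_2(ℝ) be traceless with w_{21} ≠ 0 and det w = 0, and set r_0 = -w_{11}/w_{21}. Then for every t ≥ 0 and every r ∈ ℝ, ‖(a_t u_r) w (a_t u_r)^{-1}‖ ≥ |w_{21}| · max( e^t (r - r_0)^2 , |r - r_0| ). -/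
theorem inv_aMat_mul_uMat (t r : ℝ) :
    (aMat t * uMat r)⁻¹ =
      !![Real.exp (-t / 2), -r * Real.exp (t / 2); 0, Real.exp (t / 2)] := by
  have h : Real.exp (t / 2) * Real.exp (-t / 2) = 1 := by
    rw [← Real.exp_add, neg_div, add_neg_cancel, Real.exp_zero]
  refine Matrix.inv_eq_right_inv ?_
  ext i j
  fin_cases i <;> fin_cases j <;>
    simp [aMat, uMat, Matrix.mul_apply, Fin.sum_univ_two] <;>
    first | linear_combination h | ring

theorem conj_aMat_mul_uMat_zero_zero (w : Matrix (Fin 2) (Fin 2) ℝ) (t r : ℝ) :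
    ((aMat t * uMat r) * w * (aMat t * uMat r)⁻¹) 0 0 = w 0 0 + r * w 1 0 := by
  have h : Real.exp (t / 2) * Real.exp (-t / 2) = 1 := by
    rw [← Real.exp_add, neg_div, add_neg_cancel, Real.exp_zero]
  rw [inv_aMat_mul_uMat]
  simp only [aMat, uMat, Matrix.mul_apply, Fin.sum_univ_two, Matrix.of_apply, Matrix.cons_val]
  linear_combination (w 0 0 + r * w 1 0) * h

theorem conj_aMat_mul_uMat_zero_one (w : Matrix (Fin 2) (Fin 2) ℝ) (t r : ℝ) :
    ((aMat t * uMat r) * w * (aMat t * uMat r)⁻¹) 0 1 =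
      Real.exp t * (w 0 1 + r * w 1 1 - r * w 0 0 - r ^ 2 * w 1 0) := by
  have h : Real.exp t = Real.exp (t / 2) * Real.exp (t / 2) := by
    rw [← Real.exp_add, add_halves]
  rw [inv_aMat_mul_uMat, h]
  simp only [aMat, uMat, Matrix.mul_apply, Fin.sum_univ_two, Matrix.of_apply, Matrix.cons_val]
  ring

/-- Let `w ∈ Mat₂(ℝ)` be traceless with `w₂₁ ≠ 0` and `det w = 0`, and set
`r₀ = -w₁₁/w₂₁`. Then for every `t ≥ 0` and every `r ∈ ℝ`,
`‖(a_t u_r) w (a_t u_r)⁻¹‖ ≥ |w₂₁| · max(e^t (r - r₀)², |r - r₀|)`. -/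
theorem norm_adjoint_ge_of_nilpotent
    (w : Matrix (Fin 2) (Fin 2) ℝ) (htr : w.trace = 0) (h21 : w 1 0 ≠ 0)
    (hdet : w.det = 0) (r₀ : ℝ) (hr₀ : r₀ = -(w 0 0) / w 1 0)
    (t : ℝ) (ht : 0 ≤ t) (r : ℝ) :
    |w 1 0| * max (Real.exp t * (r - r₀) ^ 2) |r - r₀| ≤
      mnorm ((aMat t * uMat r) * w * (aMat t * uMat r)⁻¹) := by
  rw [Matrix.trace_fin_two] at htr
  rw [Matrix.det_fin_two] at hdet
  have h00 : w 0 0 = -(w 1 0 * r₀) := by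
    rw [hr₀]
    field_simp
  have h11 : w 1 1 = w 1 0 * r₀ := by linarith
  have h01 : w 0 1 = -(w 1 0 * r₀ ^ 2) := by
    rw [h00, h11] at hdet
    refine mul_right_cancel₀ h21 ?_
    linear_combination -hdet
  have e00 : |((aMat t * uMat r) * w * (aMat t * uMat r)⁻¹) 0 0| = |w 1 0| * |r - r₀| := by
    rw [conj_aMat_mul_uMat_zero_zero, h00, ← abs_mul]
    congr 1
    ring
  have e01 : |((aMat t * uMat r) * w * (aMat t * uMat r)⁻¹) 0 1| =
      |w 1 0| * (Real.exp t * (r - r₀) ^ 2) := by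
    have hnn : 0 ≤ Real.exp t * (r - r₀) ^ 2 := by positivity
    rw [conj_aMat_mul_uMat_zero_one, h00, h11, h01, ← abs_of_nonneg hnn, ← abs_mul, ← abs_neg]
    congr 1
    ring
  rw [mul_max_of_nonneg _ _ (abs_nonneg _), ← e00, ← e01, max_comm]
  exact le_max_left _ _
end
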